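/- If m ∈ G(I^k), s ∈ set(m), and x_s·m/x_{min(m)} = v^k, then either s = l, or s = n and deg(m̄) = k+1, where m̄ is the part of m supported in x_1,…,x_l. -/

import Mathlib

open MvPolynomial Finset

/-- A monomial in `n` variables, recorded by its exponent vector
(index `i : Fin n` corresponds to the variable `x_{i+1}` of the paper). -/
abbrev Mon (n : ℕ) := Fin n →₀ ℕ

/-- The exponent vector of the single variable `x_{j+1}` (`0`-indexed `j`). -/
noncomputable def sing (n j : ℕ) : Mon n :=
  Finsupp.onFinset Finset.univ (fun i => if (i : ℕ) = j then 1 else 0)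
    (fun a _ => Finset.mem_univ a)

/-- Total degree of a monomial. -/
def deg {n : ℕ} (m : Mon n) : ℕ := m.sum fun _ e => e

/-- `m₁ <_lex m₂` for the lexicographic order with `x_1 > x_2 > ⋯ > x_n`. -/
def lexLT {n : ℕ} (m₁ m₂ : Mon n) : Prop :=
  ∃ i : Fin n, (∀ j : Fin n, j < i → m₁ j = m₂ j) ∧ m₁ i < m₂ i

def lexLE {n : ℕ} (m₁ m₂ : Mon n) : Prop := m₁ = m₂ ∨ lexLT m₁ m₂

/-- `m₁ <_revlex m₂` : the increasing reverse lexicographic order. -/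
def revLT {n : ℕ} (m₁ m₂ : Mon n) : Prop :=
  ∃ s : Fin n, (∀ i : Fin n, s < i → m₁ i = m₂ i) ∧ m₂ s < m₁ s

def revLE {n : ℕ} (m₁ m₂ : Mon n) : Prop := m₁ = m₂ ∨ revLT m₁ m₂

/-- `min(m)`: the (0-indexed) smallest index in the support of `m`. -/
noncomputable def minIdx {n : ℕ} (m : Mon n) : ℕ := sInf {j : ℕ | ∃ h : j < n, m ⟨j, h⟩ ≠ 0}

/-- `m̄`: the part of `m` supported in the variables `x_1, …, x_l`
(0-indexed: indices `< l`). -/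
noncomputable def lowPart {n : ℕ} (l : ℕ) (m : Mon n) : Mon n :=
  m.filter fun i => (i : ℕ) < l

/-- `m̃`: the part of `m` supported in the variables `x_{l+1}, …, x_n`
(0-indexed: indices `≥ l`). -/
noncomputable def highPart {n : ℕ} (l : ℕ) (m : Mon n) : Mon n :=
  m.filter fun i => l ≤ (i : ℕ)

/-- The exponent vector of `u = x_1 · x_{l+1}^{a_{l+1}} ⋯ x_n^{a_n}`, where
`a j` (for `l ≤ j < n`, 0-indexed) is the exponent of `x_{j+1}`. -/
noncomputable def uVec (n l : ℕ) (a : ℕ → ℕ) : Mon n :=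
  sing n 0 + ∑ j ∈ Finset.Ico l n, a j • sing n j

/-- The exponent vector of `v = x_l · x_n^{d-1}`. -/
noncomputable def vVec (n l d : ℕ) : Mon n :=
  sing n (l - 1) + (d - 1) • sing n (n - 1)

/-- The lexsegment `L(u,v)`: monomials `w` of degree `d` with `u ≥_lex w ≥_lex v`. -/
def lexSeg (n l d : ℕ) (a : ℕ → ℕ) : Set (Mon n) :=
  { w | deg w = d ∧ lexLE (vVec n l d) w ∧ lexLE w (uVec n l a) }

/-- The lexsegment ideal `I = (L(u,v)) ⊆ K[x_1,…,x_n]`. -/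
noncomputable def lexIdeal (n l d : ℕ) (a : ℕ → ℕ) (K : Type*) [Field K] :
    Ideal (MvPolynomial (Fin n) K) :=
  Ideal.span ((fun w => monomial w (1 : K)) '' lexSeg n l d a)

/-- `G(J)`: the minimal monomial generators of a monomial ideal `J`, i.e.
monomials `m ∈ J` with `m / x_i ∉ J` for every `i ∈ supp m`. -/
def minGens {n : ℕ} (K : Type*) [Field K] (J : Ideal (MvPolynomial (Fin n) K)) :
    Set (Mon n) :=
  { m | monomial m (1 : K) ∈ J ∧
      ∀ i ∈ m.support, monomial (m - Finsupp.single i 1) (1 : K) ∉ J }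

/-- `J_{<revlex m}`: the ideal generated by all `z ∈ G(J)` with `z <_revlex m`. -/
noncomputable def idealBelow {n : ℕ} (K : Type*) [Field K]
    (J : Ideal (MvPolynomial (Fin n) K)) (m : Mon n) : Ideal (MvPolynomial (Fin n) K) :=
  Ideal.span ((fun z => monomial z (1 : K)) '' { z | z ∈ minGens K J ∧ revLT z m })

/-- `set(m) = {j : x_j · m ∈ J_{<revlex m}}` (0-indexed). -/
def setOfGen {n : ℕ} (K : Type*) [Field K] (J : Ideal (MvPolynomial (Fin n) K))
    (m : Mon n) : Set ℕ :=
  { j | j < n ∧ monomial (m + sing n j) (1 : K) ∈ idealBelow K J m }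

/-- The order `≺` on monomials: compare first the degree of the part supported in
`x_1,…,x_l`, then `<_lex`. -/
def precLT {n : ℕ} (l : ℕ) (m₁ m₂ : Mon n) : Prop :=
  deg (lowPart l m₁) < deg (lowPart l m₂) ∨
    (deg (lowPart l m₁) = deg (lowPart l m₂) ∧ lexLT m₁ m₂)

/-- `w = g(z)`: `w` is the `<_revlex`-smallest minimal monomial generator of `J`
dividing the monomial `z` (the value of the decomposition function). -/
def isDecompOf {n : ℕ} (K : Type*) [Field K] (J : Ideal (MvPolynomial (Fin n) K))
    (z w : Mon n) : Prop :=
  w ∈ minGens K J ∧ w ≤ z ∧ ∀ w' ∈ minGens K J, w' ≤ z → revLE w w'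

theorem sing_app (n j : ℕ) (i : Fin n) : sing n j i = if (i : ℕ) = j then 1 else 0 := rfl

theorem sing_eq (n j : ℕ) (h : j < n) : sing n j = Finsupp.single ⟨j, h⟩ 1 := by
  ext i
  rw [sing_app, Finsupp.single_apply]
  simp only [Fin.ext_iff, eq_comm]

theorem deg_add' {n : ℕ} (p q : Mon n) : deg (p + q) = deg p + deg q :=
  Finsupp.sum_add_index' (fun _ => rfl) (fun _ _ _ => rfl)

theorem deg_single' {n : ℕ} (i : Fin n) (c : ℕ) : deg (Finsupp.single i c) = c :=
  Finsupp.sum_single_index rfl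

/-- If `m ∈ G(I^k)`, `s ∈ set(m)` and `x_s·m/x_{min(m)} = v^k`, then either
`s = l` (0-indexed: `s = l - 1`), or `s = n` (0-indexed: `s = n - 1`) and
`deg m̄ = k + 1`. -/
theorem stmt16 (n d l k : ℕ) (K : Type*) [Field K] (a : ℕ → ℕ)
    (hd : 2 ≤ d) (hl2 : 2 ≤ l) (hln : l ≤ n - 1)
    (hsum : ∑ j ∈ Finset.Ico l n, a j = d - 1) (hk : 1 ≤ k) :
    ∀ m ∈ minGens K ((lexIdeal n l d a K) ^ k),
      ∀ s ∈ setOfGen K ((lexIdeal n l d a K) ^ k) m,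
        m + sing n s - sing n (minIdx m) = k • vVec n l d →
          s = l - 1 ∨ (s = n - 1 ∧ deg (lowPart l m) = k + 1) := by
  intro m _ s hs heq
  obtain ⟨hsn, -⟩ := hs
  by_cases hsl : s = l - 1
  · exact Or.inl hsl
  right
  have hco : ∀ i : Fin n, m i + (if (i : ℕ) = s then 1 else 0)
      - (if (i : ℕ) = minIdx m then 1 else 0)
      = k * ((if (i : ℕ) = l - 1 then 1 else 0)
        + (d - 1) * (if (i : ℕ) = n - 1 then 1 else 0)) := by
    intro i
    have h := DFunLike.congr_fun heq i
    simpa [vVec, sing_app, mul_add] using h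
  have hl1 : l - 1 < n := by omega
  have hml : m ⟨l - 1, hl1⟩ ≠ 0 := by
    have h := hco ⟨l - 1, hl1⟩
    have h1 : l - 1 ≠ n - 1 := by omega
    have h2 : l - 1 ≠ s := fun h => hsl h.symm
    simp only [h1, h2, if_true, if_false] at h
    intro h0
    simp [h0] at h
    omega
  have hmem : l - 1 ∈ {j : ℕ | ∃ h : j < n, m ⟨j, h⟩ ≠ 0} := ⟨hl1, hml⟩
  have hle : minIdx m ≤ l - 1 := Nat.sInf_le hmem
  obtain ⟨hmn, hmm⟩ : ∃ h : minIdx m < n, m ⟨minIdx m, h⟩ ≠ 0 := Nat.sInf_mem ⟨_, hmem⟩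
  generalize hM : minIdx m = M at *
  have hsn1 : s = n - 1 := by
    by_contra hne
    have h := hco ⟨s, hsn⟩
    simp only [hsl, hne, if_true, if_false] at h
    by_cases hsM : s = M
    · subst hsM
      simp at h
      exact hmm h
    · simp [hsM] at h
  refine ⟨hsn1, ?_⟩
  have hlow : lowPart l m = Finsupp.single ⟨l - 1, hl1⟩ k + Finsupp.single ⟨M, hmn⟩ 1 := by
    ext i
    have h := hco i
    have hpos : (i : ℕ) = M → m i ≠ 0 := by
      intro hi
      have : i = ⟨M, hmn⟩ := Fin.ext hi
      rw [this]; exact hmm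
    rw [Finsupp.add_apply, Finsupp.single_apply, Finsupp.single_apply, lowPart,
      Finsupp.filter_apply]
    simp only [Fin.ext_iff]
    by_cases hil : (i : ℕ) < l
    · have h1 : (i : ℕ) ≠ n - 1 := by omega
      have h2 : (i : ℕ) ≠ s := by omega
      simp only [h1, h2, if_false, hil, if_true, mul_zero, add_zero] at h ⊢
      by_cases h3 : (i : ℕ) = M <;> by_cases h4 : (i : ℕ) = l - 1 <;>
        simp only [h3, h4, eq_comm, if_true, if_false] at h hpos ⊢ <;> grind
    · have h3 : l - 1 ≠ (i : ℕ) := by omega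
      have h4 : M ≠ (i : ℕ) := by omega
      simp [hil, h3, h4]
  rw [hlow, deg_add', deg_single', deg_single']
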